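/- arXiv:2209.05338 — 3 statements merged into one kernel-verified Lean document; each statement's English description precedes it below -/
import Mathlib

section
/- Fix θ ∈ (0, π/2] and set a = (cos(θ/2), sin(θ/2), 0), b = (cos(θ/2), -sin(θ/2), 0) in ℝ³; X = {+a,−a,+b,−b}; ε(±a) = (1/8)(I ± a·σ), ε(±b) = (1/8)(I ± b·σ); M^st(±a) = (1/4)(I ± a·σ), M^st(±b) = (1/4)(I ± b·σ). Define priority lists: outcome +a ↦ (+a,+b,−b,−a); −a ↦ (−a,−b,+b,+a); +b ↦ (+b,+a,−a,−b); −b ↦ (−b,−a,+a,+b), and for an excluded set S ⊂ X let g(z,S) be the first element of the priority list of outcome z not belonging to S. Then the success probability with one excluded wrong answer, E₁ = Σ_{x∈X} (1/3) Σ_{t∈X, t≠x} Σ_{z∈X} tr(ε(x) M^st(z)) · [g(z,{t}) = x], equals (3 + cos²(θ/2))/6. -/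
open Matrix

/-- For `v = (v₁, v₂, v₃) ∈ ℝ³`, the matrix `v·σ = v₁σ₁ + v₂σ₂ + v₃σ₃` where
`σ₁, σ₂, σ₃` are the Pauli matrices. -/
noncomputable def pauli (v : Fin 3 → ℝ) : Matrix (Fin 2) (Fin 2) ℂ :=
  (v 0 : ℂ) • !![0, 1; 1, 0] + (v 1 : ℂ) • !![0, -Complex.I; Complex.I, 0] +
    (v 2 : ℂ) • !![1, 0; 0, -1]

/-- The Bloch vector `a = (cos(θ/2), sin(θ/2), 0)`. -/
noncomputable def aVec (θ : ℝ) : Fin 3 → ℝ := ![Real.cos (θ/2), Real.sin (θ/2), 0]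

/-- The Bloch vector `b = (cos(θ/2), -sin(θ/2), 0)`. -/
noncomputable def bVec (θ : ℝ) : Fin 3 → ℝ := ![Real.cos (θ/2), -Real.sin (θ/2), 0]

/-- The four inputs `X = {+a, -a, +b, -b}`, indexed as `0 ↦ +a`, `1 ↦ -a`, `2 ↦ +b`,
`3 ↦ -b`. -/
noncomputable def vecX (θ : ℝ) : Fin 4 → Fin 3 → ℝ := ![aVec θ, -aVec θ, bVec θ, -bVec θ]

/-- The state ensemble `ε(±a) = (1/8)(I ± a·σ)`, `ε(±b) = (1/8)(I ± b·σ)`. -/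
noncomputable def eps (θ : ℝ) (x : Fin 4) : Matrix (Fin 2) (Fin 2) ℂ :=
  (1/8 : ℂ) • (1 + pauli (vecX θ x))

/-- The standard measurement `M^st(±a) = (1/4)(I ± a·σ)`, `M^st(±b) = (1/4)(I ± b·σ)`. -/
noncomputable def Mst (θ : ℝ) (z : Fin 4) : Matrix (Fin 2) (Fin 2) ℂ :=
  (1/4 : ℂ) • (1 + pauli (vecX θ z))

/-- The relabeling priority lists (in the indexing `0 ↦ +a`, `1 ↦ -a`, `2 ↦ +b`, `3 ↦ -b`):
outcome `+a ↦ (+a, +b, -b, -a)`, `-a ↦ (-a, -b, +b, +a)`, `+b ↦ (+b, +a, -a, -b)`,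
`-b ↦ (-b, -a, +a, +b)`. -/
def prio : Fin 4 → List (Fin 4) := ![[0, 2, 3, 1], [1, 3, 2, 0], [2, 0, 1, 3], [3, 1, 0, 2]]

/-- `guess z S` is the first element of the priority list of outcome `z` not belonging to
the excluded set `S`. -/
def guess (z : Fin 4) (S : Finset (Fin 4)) : Fin 4 :=
  ((prio z).filter (fun y => decide (y ∉ S))).headI
theorem trace_pauli_mul_pauli (v w : Fin 3 → ℝ) :
    ((1 + pauli v) * (1 + pauli w)).trace = 2 * (1 + ∑ i, (v i : ℂ) * w i) := by
  simp only [pauli, Matrix.trace_fin_two, Matrix.mul_apply, Fin.sum_univ_two, Fin.sum_univ_three]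
  simp
  ring_nf
  simp only [Complex.I_sq]
  ring

theorem trace_eps_mul_Mst (θ : ℝ) (x z : Fin 4) :
    (eps θ x * Mst θ z).trace = (1 + ∑ i, (vecX θ x i : ℂ) * vecX θ z i) / 16 := by
  simp only [eps, Mst, Matrix.smul_mul, Matrix.mul_smul, Matrix.trace_smul, trace_pauli_mul_pauli,
    smul_eq_mul]
  ring

/-- With one excluded answer, outcome `z` identifies `x` for all three wrong exclusions if `z = x`,
for one exclusion if `x` comes second in the priority list of `z`, and never otherwise. -/
theorem card_guess_eq (x z : Fin 4) :
    ((Finset.univ.erase x).filter (fun t => guess z {t} = x)).card =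
      if z = x then 3 else if z = x + 2 then 1 else 0 := by
  revert x z
  decide

theorem standard_measurement_one_exclusion (θ : ℝ) (hθ : θ ∈ Set.Ioc 0 (Real.pi / 2)) :
    (∑ x : Fin 4, (1/3 : ℂ) * ∑ t ∈ Finset.univ.erase x, ∑ z : Fin 4,
        (eps θ x * Mst θ z).trace * (if guess z {t} = x then 1 else 0)) =
      (((3 + Real.cos (θ/2) ^ 2) / 6 : ℝ) : ℂ) := by
  have key (x : Fin 4) : (∑ t ∈ Finset.univ.erase x, ∑ z : Fin 4,
      (eps θ x * Mst θ z).trace * (if guess z {t} = x then 1 else 0)) =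
      ∑ z : Fin 4, (eps θ x * Mst θ z).trace *
        ((if z = x then 3 else if z = x + 2 then 1 else 0 : ℕ) : ℂ) := by
    rw [Finset.sum_comm]
    refine Finset.sum_congr rfl fun z _ => ?_
    rw [← Finset.mul_sum, Finset.sum_boole, card_guess_eq]
  have hs : (Real.sin (θ / 2) : ℂ) ^ 2 = 1 - (Real.cos (θ / 2) : ℂ) ^ 2 := by
    exact_mod_cast Real.sin_sq (θ / 2)
  simp only [key]
  simp only [trace_eps_mul_Mst, Fin.sum_univ_four, Fin.sum_univ_three]
  simp [vecX, aVec, bVec, -Complex.ofReal_cos, -Complex.ofReal_sin]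
  linear_combination (1 / 6 : ℂ) * hs
end

section
/- Fix θ ∈ (0, π/2] and set a = (cos(θ/2), sin(θ/2), 0), b = (cos(θ/2), -sin(θ/2), 0) in ℝ³; X = {+a,−a,+b,−b}; ε(±a) = (1/8)(I ± a·σ), ε(±b) = (1/8)(I ± b·σ). Let m = (a+3b)/√(10+6cos θ), n = (3a+b)/√(10+6cos θ) and M^an(±m) = (1/4)(I ± m·σ), M^an(±n) = (1/4)(I ± n·σ), with outcome set Z = {+m,−m,+n,−n}. Define priority lists: outcome +n ↦ (+a,+b,−b,−a); −n ↦ (−a,−b,+b,+a); +m ↦ (+b,+a,−a,−b); −m ↦ (−b,−a,+a,+b), and for an excluded set S ⊂ X let g(z,S) be the first element of the priority list of outcome z not belonging to S. Then the success probability with two excluded wrong answers, E₂ = Σ_{x∈X} (1/3) Σ_{S ⊆ X∖{x}, |S|=2} Σ_{z∈Z} tr(ε(x) M^an(z)) · [g(z,S) = x], equals (6 + √(10+6cos θ))/12. -/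
open Matrix

/-- The Bloch vector `m = (a + 3b)/√(10 + 6 cos θ)`. -/
noncomputable def mVec (θ : ℝ) : Fin 3 → ℝ :=
  (Real.sqrt (10 + 6 * Real.cos θ))⁻¹ • (aVec θ + (3 : ℝ) • bVec θ)

/-- The Bloch vector `n = (3a + b)/√(10 + 6 cos θ)`. -/
noncomputable def nVec (θ : ℝ) : Fin 3 → ℝ :=
  (Real.sqrt (10 + 6 * Real.cos θ))⁻¹ • ((3 : ℝ) • aVec θ + bVec θ)

/-- The outcome set `Z = {+n, -n, +m, -m}` of the anticipative measurement, indexed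
consistently with the priority lists: `0 ↦ +n`, `1 ↦ -n`, `2 ↦ +m`, `3 ↦ -m`. -/
noncomputable def vecZ (θ : ℝ) : Fin 4 → Fin 3 → ℝ := ![nVec θ, -nVec θ, mVec θ, -mVec θ]

/-- The anticipative measurement `M^an(±m) = (1/4)(I ± m·σ)`, `M^an(±n) = (1/4)(I ± n·σ)`. -/
noncomputable def Man (θ : ℝ) (z : Fin 4) : Matrix (Fin 2) (Fin 2) ℂ :=
  (1/4 : ℂ) • (1 + pauli (vecZ θ z))

/-- The Born rule in Bloch form. -/
lemma trace_one_add_pauli_mul (v w : Fin 3 → ℝ) :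
    ((1 + pauli v) * (1 + pauli w)).trace = ((2 * (1 + v ⬝ᵥ w) : ℝ) : ℂ) := by
  simp only [pauli, Matrix.trace_fin_two, Matrix.mul_apply, Fin.sum_univ_two, dotProduct,
    Fin.sum_univ_three, Matrix.add_apply, Matrix.smul_apply, Matrix.one_apply]
  simp
  linear_combination (-2 * (v 1 : ℂ) * w 1) * Complex.I_sq

lemma trace_eps_mul_Man (θ : ℝ) (x z : Fin 4) :
    (eps θ x * Man θ z).trace = (((1 + vecX θ x ⬝ᵥ vecZ θ z) / 16 : ℝ) : ℂ) := by
  rw [eps, Man, smul_mul_smul_comm, Matrix.trace_smul, trace_one_add_pauli_mul]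
  push_cast
  rw [smul_eq_mul]
  ring

/-- An input at position `k` of a priority list is guessed for exactly `3 - k` of the excluded
pairs that avoid it. -/
lemma card_guess_eq_s8 (x z : Fin 4) :
    ((Finset.univ.filter (fun S : Finset (Fin 4) => x ∉ S ∧ S.card = 2)).filter
      (fun S => guess z S = x)).card = 3 - (prio z).idxOf x := by
  revert x z
  decide

lemma sum_guess_eq (f : Fin 4 → ℂ) (x : Fin 4) :
    ∑ S ∈ Finset.univ.filter (fun S : Finset (Fin 4) => x ∉ S ∧ S.card = 2),
        ∑ z : Fin 4, f z * (if guess z S = x then 1 else 0) =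
      ∑ z : Fin 4, f z * ((3 - (prio z).idxOf x : ℕ) : ℂ) := by
  rw [Finset.sum_comm]
  refine Finset.sum_congr rfl fun z _ => ?_
  rw [← Finset.mul_sum, Finset.sum_boole, card_guess_eq_s8]

lemma aVec_dotProduct_self (θ : ℝ) : aVec θ ⬝ᵥ aVec θ = 1 := by
  simp only [aVec, dotProduct, Fin.sum_univ_three]
  simp
  linear_combination Real.sin_sq_add_cos_sq (θ / 2)

lemma bVec_dotProduct_self (θ : ℝ) : bVec θ ⬝ᵥ bVec θ = 1 := by
  simp only [bVec, dotProduct, Fin.sum_univ_three]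
  simp
  linear_combination Real.sin_sq_add_cos_sq (θ / 2)

lemma aVec_dotProduct_bVec (θ : ℝ) : aVec θ ⬝ᵥ bVec θ = Real.cos θ := by
  have h := Real.cos_two_mul' (θ / 2)
  rw [mul_div_cancel₀ θ two_ne_zero] at h
  rw [h]
  simp only [aVec, bVec, dotProduct, Fin.sum_univ_three]
  simp
  ring

/-- The total success weight, with each input weighted by how often it is guessed. -/
lemma sum_weighted_eq (θ : ℝ) :
    ∑ x : Fin 4, (1 / 3 : ℝ) * ∑ z : Fin 4,
        (1 + vecX θ x ⬝ᵥ vecZ θ z) / 16 * ((3 - (prio z).idxOf x : ℕ) : ℝ) =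
      (6 + Real.sqrt (10 + 6 * Real.cos θ)) / 12 := by
  have hpos : 0 < 10 + 6 * Real.cos θ := by linarith [Real.neg_one_le_cos θ]
  have hr := Real.sqrt_pos.mpr hpos
  have hsq := Real.sq_sqrt hpos.le
  have hw : ∀ x z : Fin 4, 3 - (prio z).idxOf x =
      (![![3, 0, 2, 1], ![0, 3, 1, 2], ![2, 1, 3, 0], ![1, 2, 0, 3]] :
        Fin 4 → Fin 4 → ℕ) x z := by decide
  simp only [hw, Fin.sum_univ_four, vecX, vecZ, mVec, nVec]
  simp [dotProduct_add, aVec_dotProduct_self, bVec_dotProduct_self, aVec_dotProduct_bVec,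
    dotProduct_comm (bVec θ) (aVec θ)]
  field_simp
  linear_combination (-48) * hsq

theorem anticipative_measurement_two_exclusions (θ : ℝ) (hθ : θ ∈ Set.Ioc 0 (Real.pi / 2)) :
    (∑ x : Fin 4, (1/3 : ℂ) *
        ∑ S ∈ Finset.univ.filter (fun S : Finset (Fin 4) => x ∉ S ∧ S.card = 2),
          ∑ z : Fin 4,
            (eps θ x * Man θ z).trace * (if guess z S = x then 1 else 0)) =
      (((6 + Real.sqrt (10 + 6 * Real.cos θ)) / 12 : ℝ) : ℂ) := by
  rw [← sum_weighted_eq]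
  simp only [sum_guess_eq, trace_eps_mul_Man]
  push_cast
  rfl
end

section
/- Fix θ ∈ (0, π/2] and set a = (cos(θ/2), sin(θ/2), 0), b = (cos(θ/2), -sin(θ/2), 0) in ℝ³; X = {+a,−a,+b,−b}; ε(±a) = (1/8)(I ± a·σ), ε(±b) = (1/8)(I ± b·σ). Consider POVMs M̄ indexed by all functions φ : X → X (each M̄(φ) positive semidefinite 2×2 complex, Σ_φ M̄(φ) = I), with guessing probability E(M̄) = Σ_{x∈X} (1/3) Σ_{t∈X, t≠x} Σ_{φ : φ(t)=x} tr(ε(x) M̄(φ)). Then E(M̄) ≤ (4 + √(10+6cos θ))/12 for every such POVM. Moreover, letting n = (3a+b)/√(10+6cos θ) and, for j ∈ {+,−}, φ_j : X → X the function with φ_j(t) = j·a if t ≠ j·a and φ_j(t) = j·b if t = j·a, the assignment M̄(φ_j) = (1/2)(I + j·n·σ) and M̄(φ) = 0 for φ ∉ {φ₊, φ₋} defines a POVM attaining E(M̄) = (4 + √(10+6cos θ))/12. -/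
open Matrix
open scoped ComplexOrder

open Matrix

/-- `φ₊ : X → X` with `φ₊(t) = +a` if `t ≠ +a` and `φ₊(t) = +b` if `t = +a`
(in the indexing `0 ↦ +a`, `1 ↦ -a`, `2 ↦ +b`, `3 ↦ -b`). -/
def phiPlus : Fin 4 → Fin 4 := fun t => if t = 0 then 2 else 0

/-- `φ₋ : X → X` with `φ₋(t) = -a` if `t ≠ -a` and `φ₋(t) = -b` if `t = -a`. -/
def phiMinus : Fin 4 → Fin 4 := fun t => if t = 1 then 3 else 1

/-- The optimal measurement `M̄` of Theorem 1 with `k = 1`: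
`M̄(φ_j) = (1/2)(I + j n·σ)` and `M̄(φ) = 0` otherwise. -/
noncomputable def MbarOne (θ : ℝ) (φ : Fin 4 → Fin 4) : Matrix (Fin 2) (Fin 2) ℂ :=
  if φ = phiPlus then (1/2 : ℂ) • (1 + pauli (nVec θ))
  else if φ = phiMinus then (1/2 : ℂ) • (1 - pauli (nVec θ))
  else 0

lemma pauli_add (u v : Fin 3 → ℝ) : pauli (u + v) = pauli u + pauli v := by
  simp only [pauli, Pi.add_apply, Complex.ofReal_add, add_smul]
  abel

lemma pauli_smul (c : ℝ) (v : Fin 3 → ℝ) : pauli (c • v) = (c : ℂ) • pauli v := by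
  simp only [pauli, Pi.smul_apply, smul_eq_mul, Complex.ofReal_mul, mul_smul, smul_add]

lemma pauli_neg (v : Fin 3 → ℝ) : pauli (-v) = -pauli v := by
  simpa using pauli_smul (-1) v

lemma pauli_sum {ι : Type*} (s : Finset ι) (f : ι → Fin 3 → ℝ) :
    pauli (∑ i ∈ s, f i) = ∑ i ∈ s, pauli (f i) := by
  classical
  induction s using Finset.induction_on with
  | empty => simpa using pauli_smul 0 0
  | insert i s hi ih => rw [Finset.sum_insert hi, Finset.sum_insert hi, pauli_add, ih]

lemma isHermitian_pauli (v : Fin 3 → ℝ) : (pauli v).IsHermitian := by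
  ext i j
  fin_cases i <;> fin_cases j <;> simp [pauli]

lemma trace_pauli (v : Fin 3 → ℝ) : (pauli v).trace = 0 := by
  simp [pauli, Matrix.trace_fin_two]

lemma pauli_mul_pauli_self (v : Fin 3 → ℝ) :
    pauli v * pauli v = ((v ⬝ᵥ v : ℝ) : ℂ) • (1 : Matrix (Fin 2) (Fin 2) ℂ) := by
  ext i j
  fin_cases i <;> fin_cases j <;>
    simp [pauli, Matrix.mul_apply, dotProduct, Fin.sum_univ_three] <;>
    first
    | ring1
    | linear_combination (-(v 1 : ℂ) ^ 2) * Complex.I_sq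

/-- `r I + v·σ` is positive semidefinite as soon as `|v| ≤ r`. -/
lemma posSemidef_smul_one_add_pauli {r : ℝ} {v : Fin 3 → ℝ} (hv : √(v ⬝ᵥ v) ≤ r) :
    ((r : ℂ) • (1 : Matrix (Fin 2) (Fin 2) ℂ) + pauli v).PosSemidef := by
  set s := √(v ⬝ᵥ v) with hs
  have hvv : 0 ≤ v ⬝ᵥ v := by
    simpa using dotProduct_star_self_nonneg v
  have hss : s * s = v ⬝ᵥ v := Real.mul_self_sqrt hvv
  have hpsd : ((s : ℂ) • (1 : Matrix (Fin 2) (Fin 2) ℂ) + pauli v).PosSemidef := by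
    rcases (Real.sqrt_nonneg (v ⬝ᵥ v)).eq_or_lt with h0 | hpos
    · have hs0 : s = 0 := h0.symm
      have hv0 : v = 0 := dotProduct_self_eq_zero.mp (by rw [← hss, hs0, mul_zero])
      have hp0 : pauli 0 = 0 := by simpa using pauli_smul 0 0
      rw [hs0, hv0, hp0]
      simpa using Matrix.PosSemidef.zero
    · have hs0 : (s : ℂ) ≠ 0 := by exact_mod_cast hpos.ne'
      set B := (s : ℂ) • (1 : Matrix (Fin 2) (Fin 2) ℂ) + pauli v with hB
      have hBH : Bᴴ = B := by
        rw [hB, conjTranspose_add, conjTranspose_smul, (isHermitian_pauli v).eq]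
        simp
      have hBB : B * B = (2 * s : ℂ) • B := by
        rw [hB, add_mul, mul_add, mul_add, pauli_mul_pauli_self, ← hss]
        simp only [smul_mul_assoc, mul_smul_comm, one_mul, mul_one, Complex.ofReal_mul]
        module
      have hBeq : B = ((2 * s)⁻¹ : ℝ) • (Bᴴ * B) := by
        rw [hBH, hBB, ← Complex.coe_smul, smul_smul]
        push_cast
        rw [inv_mul_cancel₀ (mul_ne_zero two_ne_zero hs0), one_smul]
      rw [hBeq]
      exact (posSemidef_conjTranspose_mul_self B).smul (by positivity)
  have hrest : (((r - s : ℝ)) • (1 : Matrix (Fin 2) (Fin 2) ℂ)).PosSemidef :=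
    Matrix.PosSemidef.one.smul (sub_nonneg.mpr hv)
  convert hpsd.add hrest using 1
  rw [← Complex.coe_smul]
  push_cast
  module

open scoped MatrixOrder in
lemma Matrix.PosSemidef.trace_mul_nonneg_of_posSemidef {n : Type*} [Fintype n]
    {A B : Matrix n n ℂ} (hA : A.PosSemidef) (hB : B.PosSemidef) : 0 ≤ (A * B).trace := by
  classical
  obtain ⟨C, rfl⟩ := CStarAlgebra.nonneg_iff_eq_star_mul_self.mp hA.nonneg
  rw [star_eq_conjTranspose, mul_assoc, trace_mul_comm]
  exact (hB.mul_mul_conjTranspose_same C).trace_nonneg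

/-- The operator whose trace against `M̄(φ)` is the contribution of `φ` to the guessing
probability. -/
noncomputable def guessOperator (θ : ℝ) (φ : Fin 4 → Fin 4) : Matrix (Fin 2) (Fin 2) ℂ :=
  ∑ t with φ t ≠ t, (1/3 : ℂ) • eps θ (φ t)

lemma guessing_sum_eq (θ : ℝ) (M : (Fin 4 → Fin 4) → Matrix (Fin 2) (Fin 2) ℂ) :
    (∑ x : Fin 4, (1/3 : ℂ) * ∑ t ∈ Finset.univ.erase x,
        ∑ φ ∈ Finset.univ.filter (fun φ : Fin 4 → Fin 4 => φ t = x), (eps θ x * M φ).trace) =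
      ∑ φ, (guessOperator θ φ * M φ).trace := by
  have hR : ∀ φ, (guessOperator θ φ * M φ).trace =
      ∑ t, ∑ x, if φ t = x then (if t ≠ x then (1/3 : ℂ) * (eps θ x * M φ).trace else 0)
        else 0 := by
    intro φ
    simp only [guessOperator, Finset.sum_mul, trace_sum, Finset.sum_filter, smul_mul_assoc,
      trace_smul, smul_eq_mul, Finset.sum_ite_eq, Finset.mem_univ, if_true, ne_comm, ite_mul,
      zero_mul, apply_ite Matrix.trace, trace_zero]
  have hL : ∀ x, (1/3 : ℂ) * ∑ t ∈ Finset.univ.erase x,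
        ∑ φ ∈ Finset.univ.filter (fun φ : Fin 4 → Fin 4 => φ t = x), (eps θ x * M φ).trace =
      ∑ t, ∑ φ : Fin 4 → Fin 4,
        if φ t = x then (if t ≠ x then (1/3 : ℂ) * (eps θ x * M φ).trace else 0) else 0 := by
    intro x
    rw [← Finset.filter_ne', Finset.sum_filter, Finset.mul_sum]
    refine Finset.sum_congr rfl fun t _ => ?_
    by_cases h : t = x <;> simp [h, Finset.sum_filter, Finset.mul_sum]
  simp only [hR, hL]
  rw [Finset.sum_comm' (t' := Finset.univ) (s' := fun _ => Finset.univ) (by simp)]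
  rw [Finset.sum_comm (s := (Finset.univ : Finset (Fin 4 → Fin 4)))]
  exact Finset.sum_congr rfl fun t _ => Finset.sum_comm

/-- The coordinate of an input along `a`. -/
def coordA : Fin 4 → ℤ := ![1, -1, 0, 0]

/-- The coordinate of an input along `b`. -/
def coordB : Fin 4 → ℤ := ![0, 0, 1, -1]

lemma vecX_eq (θ : ℝ) (x : Fin 4) :
    vecX θ x = (coordA x : ℝ) • aVec θ + (coordB x : ℝ) • bVec θ := by
  fin_cases x <;> simp [vecX, coordA, coordB]

lemma guessOperator_eq (θ : ℝ) (φ : Fin 4 → Fin 4) :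
    guessOperator θ φ = ((1/24 : ℝ) : ℂ) •
      (((Finset.univ.filter fun t => φ t ≠ t).card : ℂ) • (1 : Matrix (Fin 2) (Fin 2) ℂ) +
        pauli (((∑ t with φ t ≠ t, coordA (φ t) : ℤ) : ℝ) • aVec θ +
          ((∑ t with φ t ≠ t, coordB (φ t) : ℤ) : ℝ) • bVec θ)) := by
  have hw : ((∑ t with φ t ≠ t, coordA (φ t) : ℤ) : ℝ) • aVec θ +
      ((∑ t with φ t ≠ t, coordB (φ t) : ℤ) : ℝ) • bVec θ = ∑ t with φ t ≠ t, vecX θ (φ t) := by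
    simp only [vecX_eq, Finset.sum_add_distrib, Int.cast_sum, Finset.sum_smul]
  rw [hw, pauli_sum, guessOperator]
  simp only [eps, smul_smul, smul_add, Finset.sum_add_distrib, Finset.sum_const,
    Finset.smul_sum]
  rw [← Nat.cast_smul_eq_nsmul ℂ, smul_smul]
  congr 1
  · congr 1
    push_cast
    ring
  · norm_num

set_option maxRecDepth 100000 in
lemma coord_sums_bound (φ : Fin 4 → Fin 4) :
    (∑ t with φ t ≠ t, coordA (φ t)) ^ 2 + (∑ t with φ t ≠ t, coordB (φ t)) ^ 2 ≤ 10 ∧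
      ((∑ t with φ t ≠ t, coordA (φ t)) + ∑ t with φ t ≠ t, coordB (φ t)) ^ 2 ≤ 16 := by
  revert φ
  decide

lemma dotProduct_smul_aVec_add_smul_bVec (θ p q : ℝ) :
    (p • aVec θ + q • bVec θ) ⬝ᵥ (p • aVec θ + q • bVec θ) =
      p ^ 2 + q ^ 2 + 2 * p * q * Real.cos θ := by
  have h1 : Real.cos θ = 2 * Real.cos (θ/2) ^ 2 - 1 := by
    rw [← Real.cos_two_mul]; ring_nf
  have h2 := Real.sin_sq_add_cos_sq (θ/2)
  simp only [dotProduct, Fin.sum_univ_three, aVec, bVec, Pi.add_apply, Pi.smul_apply,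
    smul_eq_mul, cons_val]
  rw [h1]
  linear_combination (p - q) ^ 2 * h2

lemma trace_guessOperator_mul_le {θ : ℝ} (hθ : 0 ≤ Real.cos θ) (φ : Fin 4 → Fin 4)
    {M : Matrix (Fin 2) (Fin 2) ℂ} (hM : M.PosSemidef) :
    (guessOperator θ φ * M).trace ≤ (((4 + √(10 + 6 * Real.cos θ)) / 24 : ℝ) : ℂ) * M.trace := by
  set p := ∑ t with φ t ≠ t, coordA (φ t) with hp
  set q := ∑ t with φ t ≠ t, coordB (φ t) with hq
  set m := (Finset.univ.filter fun t => φ t ≠ t).card with hm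
  obtain ⟨h10, h16⟩ := coord_sums_bound φ
  rw [← hp, ← hq] at h10 h16
  have h10' : (p : ℝ) ^ 2 + (q : ℝ) ^ 2 ≤ 10 := by exact_mod_cast h10
  have h16' : ((p : ℝ) + q) ^ 2 ≤ 16 := by exact_mod_cast h16
  have hm4 : (m : ℝ) ≤ 4 := by
    exact_mod_cast (Finset.card_le_univ _).trans_eq (Fintype.card_fin 4)
  set w := (p : ℝ) • aVec θ + (q : ℝ) • bVec θ with hw
  have hwle : √(-w ⬝ᵥ -w) ≤ 4 + √(10 + 6 * Real.cos θ) - m := by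
    have : √(-w ⬝ᵥ -w) ≤ √(10 + 6 * Real.cos θ) := by
      refine Real.sqrt_le_sqrt ?_
      rw [neg_dotProduct_neg, hw, dotProduct_smul_aVec_add_smul_bVec]
      nlinarith [Real.cos_le_one θ, mul_le_mul_of_nonneg_left h16' hθ,
        mul_le_mul_of_nonneg_left h10' (sub_nonneg.mpr (Real.cos_le_one θ))]
    linarith
  have hpos := (posSemidef_smul_one_add_pauli hwle).trace_mul_nonneg_of_posSemidef hM
  have h24 : (0 : ℂ) ≤ ((1/24 : ℝ) : ℂ) := by
    rw [Complex.zero_le_real]; norm_num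
  have key := mul_nonneg h24 hpos
  rw [guessOperator_eq, ← hm, ← hp, ← hq, ← hw, ← sub_nonneg]
  refine key.trans_eq ?_
  rw [pauli_neg]
  simp only [add_mul, smul_mul_assoc, one_mul, trace_add, trace_smul, smul_eq_mul, neg_mul,
    trace_neg]
  push_cast
  ring

lemma phiPlus_ne_phiMinus : phiPlus ≠ phiMinus := by decide

lemma nVec_dotProduct_self {θ : ℝ} (h : 0 < 10 + 6 * Real.cos θ) : nVec θ ⬝ᵥ nVec θ = 1 := by
  have hb := dotProduct_smul_aVec_add_smul_bVec θ 3 1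
  rw [one_smul] at hb
  rw [nVec, smul_dotProduct, dotProduct_smul, hb, smul_smul, smul_eq_mul, ← mul_inv,
    Real.mul_self_sqrt h.le]
  field_simp
  ring

lemma posSemidef_half_smul_one_add_pauli {v : Fin 3 → ℝ} (hv : v ⬝ᵥ v = 1) :
    ((1/2 : ℂ) • (1 + pauli v)).PosSemidef := by
  have h := posSemidef_smul_one_add_pauli (r := 1) (v := v) (by simp [hv])
  simpa [← Complex.coe_smul] using h.smul (show (0 : ℝ) ≤ 1/2 by norm_num)

lemma MbarOne_posSemidef {θ : ℝ} (h : 0 < 10 + 6 * Real.cos θ) (φ : Fin 4 → Fin 4) :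
    (MbarOne θ φ).PosSemidef := by
  have hn := nVec_dotProduct_self h
  unfold MbarOne
  split_ifs
  · exact posSemidef_half_smul_one_add_pauli hn
  · rw [sub_eq_add_neg, ← pauli_neg]
    exact posSemidef_half_smul_one_add_pauli (by rw [neg_dotProduct_neg, hn])
  · exact Matrix.PosSemidef.zero

lemma sum_eq_phiPlus_add_phiMinus {E : Type*} [AddCommMonoid E] (f : (Fin 4 → Fin 4) → E)
    (hf : ∀ φ, φ ≠ phiPlus → φ ≠ phiMinus → f φ = 0) :
    ∑ φ, f φ = f phiPlus + f phiMinus :=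
  Fintype.sum_eq_add _ _ phiPlus_ne_phiMinus fun φ h => hf φ h.1 h.2

lemma MbarOne_phiPlus (θ : ℝ) : MbarOne θ phiPlus = (1/2 : ℂ) • (1 + pauli (nVec θ)) := by
  simp [MbarOne]

lemma MbarOne_phiMinus (θ : ℝ) : MbarOne θ phiMinus = (1/2 : ℂ) • (1 - pauli (nVec θ)) := by
  simp [MbarOne, phiPlus_ne_phiMinus.symm]

lemma MbarOne_of_ne (θ : ℝ) {φ : Fin 4 → Fin 4} (h₁ : φ ≠ phiPlus) (h₂ : φ ≠ phiMinus) :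
    MbarOne θ φ = 0 := by
  simp [MbarOne, h₁, h₂]

lemma sum_MbarOne (θ : ℝ) : ∑ φ, MbarOne θ φ = 1 := by
  rw [sum_eq_phiPlus_add_phiMinus _ fun φ => MbarOne_of_ne θ, MbarOne_phiPlus, MbarOne_phiMinus]
  module

lemma three_smul_aVec_add_bVec {θ : ℝ} (h : 0 < 10 + 6 * Real.cos θ) :
    (3 : ℝ) • aVec θ + bVec θ = √(10 + 6 * Real.cos θ) • nVec θ := by
  rw [nVec, smul_smul, mul_inv_cancel₀ (Real.sqrt_pos.mpr h).ne', one_smul]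

lemma guessOperator_phiPlus {θ : ℝ} (h : 0 < 10 + 6 * Real.cos θ) :
    guessOperator θ phiPlus = (1/24 : ℂ) •
      ((4 : ℂ) • 1 + (√(10 + 6 * Real.cos θ) : ℂ) • pauli (nVec θ)) := by
  have hm : (Finset.univ.filter fun t => phiPlus t ≠ t).card = 4 := by decide
  have hp : ∑ t with phiPlus t ≠ t, coordA (phiPlus t) = 3 := by decide
  have hq : ∑ t with phiPlus t ≠ t, coordB (phiPlus t) = 1 := by decide
  rw [guessOperator_eq, hm, hp, hq, ← pauli_smul, ← three_smul_aVec_add_bVec h]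
  simp

lemma guessOperator_phiMinus {θ : ℝ} (h : 0 < 10 + 6 * Real.cos θ) :
    guessOperator θ phiMinus = (1/24 : ℂ) •
      ((4 : ℂ) • 1 - (√(10 + 6 * Real.cos θ) : ℂ) • pauli (nVec θ)) := by
  have hm : (Finset.univ.filter fun t => phiMinus t ≠ t).card = 4 := by decide
  have hp : ∑ t with phiMinus t ≠ t, coordA (phiMinus t) = -3 := by decide
  have hq : ∑ t with phiMinus t ≠ t, coordB (phiMinus t) = -1 := by decide
  rw [guessOperator_eq, hm, hp, hq, ← pauli_smul, ← three_smul_aVec_add_bVec h, sub_eq_add_neg,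
    ← pauli_neg]
  simp [add_comm]

lemma sum_trace_guessOperator_mul_MbarOne {θ : ℝ} (h : 0 < 10 + 6 * Real.cos θ) :
    ∑ φ, (guessOperator θ φ * MbarOne θ φ).trace =
      (((4 + √(10 + 6 * Real.cos θ)) / 12 : ℝ) : ℂ) := by
  rw [sum_eq_phiPlus_add_phiMinus _ fun φ h₁ h₂ => by rw [MbarOne_of_ne θ h₁ h₂]; simp,
    MbarOne_phiPlus, MbarOne_phiMinus, guessOperator_phiPlus h, guessOperator_phiMinus h]
  have hnn : (pauli (nVec θ) * pauli (nVec θ)).trace = 2 := by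
    simp [pauli_mul_pauli_self, nVec_dotProduct_self h]
  simp only [add_mul, sub_mul, mul_add, mul_sub, smul_mul_assoc, mul_smul_comm, one_mul, mul_one,
    trace_add, trace_sub, trace_smul, smul_eq_mul, hnn, trace_pauli, trace_one, Fintype.card_fin]
  push_cast
  ring

theorem guessing_game_one_exclusion_optimum (θ : ℝ) (hθ : θ ∈ Set.Ioc 0 (Real.pi / 2)) :
    (∀ Mbar : (Fin 4 → Fin 4) → Matrix (Fin 2) (Fin 2) ℂ,
      (∀ φ, (Mbar φ).PosSemidef) → (∑ φ : Fin 4 → Fin 4, Mbar φ) = 1 →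
      (∑ x : Fin 4, (1/3 : ℂ) * ∑ t ∈ Finset.univ.erase x,
          ∑ φ ∈ Finset.univ.filter (fun φ : Fin 4 → Fin 4 => φ t = x),
            (eps θ x * Mbar φ).trace) ≤
        (((4 + Real.sqrt (10 + 6 * Real.cos θ)) / 12 : ℝ) : ℂ)) ∧
    (∀ φ, (MbarOne θ φ).PosSemidef) ∧ (∑ φ : Fin 4 → Fin 4, MbarOne θ φ) = 1 ∧
    (∑ x : Fin 4, (1/3 : ℂ) * ∑ t ∈ Finset.univ.erase x,
        ∑ φ ∈ Finset.univ.filter (fun φ : Fin 4 → Fin 4 => φ t = x),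
          (eps θ x * MbarOne θ φ).trace) =
      (((4 + Real.sqrt (10 + 6 * Real.cos θ)) / 12 : ℝ) : ℂ) := by
  have hcos : 0 ≤ Real.cos θ :=
    Real.cos_nonneg_of_neg_pi_div_two_le_of_le (by linarith [hθ.1, Real.pi_pos]) hθ.2
  have hpos : 0 < 10 + 6 * Real.cos θ := by linarith
  refine ⟨fun Mbar hM hsum => ?_, MbarOne_posSemidef hpos, sum_MbarOne θ, ?_⟩
  · rw [guessing_sum_eq]
    refine (Finset.sum_le_sum fun φ _ => trace_guessOperator_mul_le hcos φ (hM φ)).trans_eq ?_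
    rw [← Finset.mul_sum, ← trace_sum, hsum, trace_one, Fintype.card_fin]
    push_cast
    ring
  · rw [guessing_sum_eq, sum_trace_guessOperator_mul_MbarOne hpos]
end
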